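/- Let s be a natural number with s ≢ 2 (mod 3), let m = 12s + 11 and δ = (24s+23)(48s+45), and suppose that l = 8m + 3 is prime. If n is an odd perfect number such that n + δ is perfect, and p is a prime with 2^p - 1 prime and n + δ = 2^(p-1)·(2^p - 1), then gcd(2^(p-1) - 2m - 1, 2^p + 4m + 1) = 1. -/

import Mathlib

lemma four_dvd_sum_divisors (u : ℕ) (hu : u % 4 = 3) : 4 ∣ ∑ d ∈ u.divisors, d := by
  have hpos : 0 < u := by omega
  have key : ∀ d e : ℕ, d * e = u → (d % 4 = 1 ∧ e % 4 = 3) ∨ (d % 4 = 3 ∧ e % 4 = 1) := by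
    intro d e h
    have h1 : ((d % 4) * (e % 4)) % 4 = 3 := by rw [← Nat.mul_mod, h, hu]
    have hd : d % 4 < 4 := Nat.mod_lt _ (by norm_num)
    have he : e % 4 < 4 := Nat.mod_lt _ (by norm_num)
    generalize d % 4 = x at *
    generalize e % 4 = y at *
    interval_cases x <;> interval_cases y <;> simp_all
  have hs : ∑ d ∈ u.divisors with ¬ d % 4 = 1, d = ∑ d ∈ u.divisors with d % 4 = 1, u / d := by
    refine Finset.sum_nbij' (fun d => u / d) (fun d => u / d) ?_ ?_ ?_ ?_ ?_
    · intro d hd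
      simp only [Finset.mem_filter, Nat.mem_divisors] at hd ⊢
      have := key d (u / d) (Nat.mul_div_cancel' hd.1.1)
      exact ⟨⟨Nat.div_dvd_of_dvd hd.1.1, hd.1.2⟩, by omega⟩
    · intro d hd
      simp only [Finset.mem_filter, Nat.mem_divisors] at hd ⊢
      have := key d (u / d) (Nat.mul_div_cancel' hd.1.1)
      exact ⟨⟨Nat.div_dvd_of_dvd hd.1.1, hd.1.2⟩, by omega⟩
    all_goals
      intro d hd
      simp only [Finset.mem_filter, Nat.mem_divisors] at hd
      exact (by simp [Nat.div_div_self hd.1.1 hd.1.2])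
  rw [← Finset.sum_filter_add_sum_filter_not u.divisors (fun d => d % 4 = 1), hs,
    ← Finset.sum_add_distrib]
  refine Finset.dvd_sum ?_
  intro d hd
  simp only [Finset.mem_filter, Nat.mem_divisors] at hd
  have := key d (u / d) (Nat.mul_div_cancel' hd.1.1)
  omega

lemma no_split (n u v : ℕ) (hodd : Odd n) (hn : Nat.Perfect n) (h : n = u * v)
    (hc : Nat.Coprime u v) (hu : u % 4 = 3) : False := by
  have h1 : ∑ d ∈ n.divisors, d = 2 * n := by
    rw [Nat.sum_divisors_eq_sum_properDivisors_add_self, hn.1]; ring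
  have h2 : ∑ d ∈ n.divisors, d = (∑ d ∈ u.divisors, d) * ∑ d ∈ v.divisors, d := by
    rw [h]; exact hc.sum_divisors_mul
  have h3 : 4 ∣ 2 * n := by
    rw [← h1, h2]; exact (four_dvd_sum_divisors u hu).mul_right _
  obtain ⟨k, hk⟩ := hodd
  omega

theorem stmt_16 (s m n p : ℕ) (hs : s % 3 ≠ 2) (hm : m = 12 * s + 11)
    (hl : Nat.Prime (8 * m + 3))
    (hodd : Odd n) (hn : Nat.Perfect n)
    (hnδ : Nat.Perfect (n + (24 * s + 23) * (48 * s + 45)))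
    (hp : Nat.Prime p) (hQ : Nat.Prime (2 ^ p - 1))
    (hform : n + (24 * s + 23) * (48 * s + 45) = 2 ^ (p - 1) * (2 ^ p - 1)) :
    Nat.gcd (2 ^ (p - 1) - 2 * m - 1) (2 ^ p + 4 * m + 1) = 1 := by
  have e1 : 24 * s + 23 = 2 * m + 1 := by omega
  have e2 : 48 * s + 45 = 4 * m + 1 := by omega
  rw [e1, e2] at hform
  have hm4 : m % 4 = 3 := by omega
  have hp2 : p ≠ 2 := by
    rintro rfl
    norm_num at hform
    nlinarith
  have hp3 : 3 ≤ p := by have := hp.two_le; omega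
  obtain ⟨q, rfl⟩ : ∃ q, p = q + 3 := ⟨p - 3, by omega⟩
  have hx : 2 ^ (q + 3 - 1) = 4 * 2 ^ q := by
    rw [show q + 3 - 1 = q + 2 by omega, pow_add]; ring
  have hy : 2 ^ (q + 3) = 8 * 2 ^ q := by rw [pow_add]; ring
  rw [hx, hy] at hform ⊢
  clear hx hy hQ
  have hz : 0 < 2 ^ q := by positivity
  generalize 2 ^ q = z at *
  obtain ⟨w, hw⟩ : ∃ w, 8 * z - 1 = w := ⟨_, rfl⟩
  rw [hw] at hform
  have hw' : 8 * z = w + 1 := by omega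
  have hnpos : 0 < n := hn.2
  have hgt : 2 * m + 1 < 4 * z := by
    by_contra hcon
    have h1 : w ≤ 4 * m + 1 := by omega
    have := Nat.mul_le_mul (not_lt.mp hcon) h1
    omega
  obtain ⟨A, hA⟩ : ∃ A, 4 * z = A + 2 * m + 1 := ⟨4 * z - (2 * m + 1), by omega⟩
  have hA' : 4 * z - 2 * m - 1 = A := by omega
  have hB' : 8 * z + 4 * m + 1 = 2 * A + (8 * m + 3) := by omega
  rw [hA', hB']
  have hw2 : w = 2 * A + 4 * m + 1 := by omega
  have hnAB : n = A * (2 * A + (8 * m + 3)) := by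
    rw [hw2, hA] at hform
    nlinarith
  have hA4 : A % 4 = 1 := by omega
  have hl4 : (8 * m + 3) % 4 = 3 := by omega
  clear hnδ hform
  generalize 8 * m + 3 = l at *
  by_contra hg
  have hlA : l ∣ A := by
    by_contra hnd
    apply hg
    have h1 : Nat.Coprime l A := (Nat.Prime.coprime_iff_not_dvd hl).2 hnd
    rw [add_comm (2 * A) l]
    simpa using h1.symm
  obtain ⟨a, rfl⟩ := hlA
  have ha4 : a % 4 = 3 := by
    rw [Nat.mul_mod, hl4] at hA4
    omega
  have hab : Nat.Coprime a (2 * a + 1) := by simp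
  by_cases hla : l ∣ a
  · have hlb : Nat.Coprime l (2 * a + 1) := by
      obtain ⟨c, rfl⟩ := hla
      rw [show 2 * (l * c) + 1 = 1 + l * (2 * c) by ring]; simp
    refine no_split n (l * l * a) (2 * a + 1) hodd hn (by rw [hnAB]; ring) ?_ ?_
    · exact (hlb.mul_left hlb).mul_left hab
    · simp [Nat.mul_mod, hl4, ha4]
  · have hl' : Nat.Coprime a l := ((Nat.Prime.coprime_iff_not_dvd hl).2 hla).symm
    refine no_split n a (l * l * (2 * a + 1)) hodd hn (by rw [hnAB]; ring) ?_ ha4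
    exact (hl'.mul_right hl').mul_right hab
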